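/- Convexity and monotonicity of the nonanticipative RDF in the distortion level (Lemma 4, finite-alphabet form): let 𝒳_0,…,𝒳_n and 𝒴_0,…,𝒴_n be nonempty finite sets, P a probability measure on ∏𝒳_i, and d : (∏𝒳_i) × (∏𝒴_i) → [0,∞) a function. For D ≥ 0 define R^{na}_{0,n}(D) as the infimum (in [0,∞], with infimum over the empty set equal to +∞) of the Kullback–Leibler divergence of μ from the product of its two marginals, over all joint probability measures μ on (∏𝒳_i) × (∏𝒴_i) whose ∏𝒳_i-marginal equals P, which satisfy ∫ d dμ ≤ (n+1)D, and for which, for every i = 0,…,n−1, (X_{i+1},…,X_n) is conditionally independent of (Y_0,…,Y_i) given (X_0,…,X_i) under μ. Then the function D ↦ R^{na}_{0,n}(D) is nonincreasing on [0,∞) and convex: for all D₁, D₂ ≥ 0 and λ ∈ [0,1], R^{na}_{0,n}(λD₁ + (1−λ)D₂) ≤ λ R^{na}_{0,n}(D₁) + (1−λ) R^{na}_{0,n}(D₂). -/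

import Mathlib

open MeasureTheory ProbabilityTheory
open scoped NNReal ENNReal Classical

/-- Kullback–Leibler divergence of `μ` from `ν`: `∫ log(dμ/dν) dμ` when `μ ≪ ν` and the
log-likelihood ratio is `μ`-integrable, and `∞` otherwise. -/
noncomputable def klDivergence {α : Type*} [MeasurableSpace α] (μ ν : Measure α) : ℝ≥0∞ :=
  if μ ≪ ν ∧ Integrable (llr μ ν) μ then ENNReal.ofReal (∫ x, llr μ ν x ∂μ) else ∞

/-- Mutual information `I(X^n; Y^n)` of a joint measure on a product space: the KL divergence
of the joint measure from the product of its two marginals. -/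
noncomputable def mutualInfoProd {α β : Type*} [MeasurableSpace α] [MeasurableSpace β]
    (μ : Measure (α × β)) : ℝ≥0∞ :=
  klDivergence μ ((μ.map Prod.fst).prod (μ.map Prod.snd))

open InformationTheory

/-- For probability measures, `klDivergence` agrees with Mathlib's `klDiv`. -/
lemma klDivergence_eq_klDiv {α : Type*} [MeasurableSpace α] (μ ν : Measure α)
    [IsProbabilityMeasure μ] [IsProbabilityMeasure ν] : klDivergence μ ν = klDiv μ ν := by
  simp [klDivergence, klDiv_def]

/-- The Kullback–Leibler divergence is jointly subadditive. -/
lemma klDiv_add_le {α : Type*} [MeasurableSpace α] (μ₁ μ₂ ν₁ ν₂ : Measure α)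
    [IsFiniteMeasure μ₁] [IsFiniteMeasure μ₂] [IsFiniteMeasure ν₁] [IsFiniteMeasure ν₂] :
    klDiv (μ₁ + μ₂) (ν₁ + ν₂) ≤ klDiv μ₁ ν₁ + klDiv μ₂ ν₂ := by
  by_cases h₁ : μ₁ ≪ ν₁
  swap; · simp [h₁]
  by_cases h₂ : μ₂ ≪ ν₂
  swap; · simp [h₂]
  have hν₁ : ν₁ ≪ ν₁ + ν₂ := Measure.AbsolutelyContinuous.rfl.add_right _
  have hν₂ : ν₂ ≪ ν₁ + ν₂ := by
    rw [add_comm]; exact Measure.AbsolutelyContinuous.rfl.add_right _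
  rw [klDiv_eq_lintegral_klFun_of_ac h₁, klDiv_eq_lintegral_klFun_of_ac h₂,
    klDiv_eq_lintegral_klFun_of_ac
      (Measure.AbsolutelyContinuous.add_left (h₁.trans hν₁) (h₂.trans hν₂)),
    ← lintegral_rnDeriv_mul hν₁ (by fun_prop), ← lintegral_rnDeriv_mul hν₂ (by fun_prop),
    ← lintegral_add_left (by fun_prop)]
  refine lintegral_mono_ae ?_
  filter_upwards [Measure.rnDeriv_add' μ₁ μ₂ (ν₁ + ν₂), Measure.rnDeriv_add' ν₁ ν₂ (ν₁ + ν₂),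
    Measure.rnDeriv_self (ν₁ + ν₂), Measure.rnDeriv_mul_rnDeriv h₁ (κ := ν₁ + ν₂),
    Measure.rnDeriv_mul_rnDeriv h₂ (κ := ν₁ + ν₂),
    Measure.rnDeriv_ne_top ν₁ (ν₁ + ν₂), Measure.rnDeriv_ne_top ν₂ (ν₁ + ν₂),
    Measure.rnDeriv_ne_top μ₁ (ν₁ + ν₂), Measure.rnDeriv_ne_top μ₂ (ν₁ + ν₂)]
    with x hμ hν hself hx₁ hx₂ ht₁ ht₂ hs₁ hs₂
  simp only [Pi.add_apply, Pi.mul_apply] at hμ hν hx₁ hx₂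
  rw [hself] at hν
  have hsum : (ν₁.rnDeriv (ν₁ + ν₂) x).toReal + (ν₂.rnDeriv (ν₁ + ν₂) x).toReal = 1 := by
    rw [← ENNReal.toReal_add ht₁ ht₂, ← hν, ENNReal.toReal_one]
  have hconv := convexOn_klFun.2 (x := (μ₁.rnDeriv ν₁ x).toReal) (y := (μ₂.rnDeriv ν₂ x).toReal)
    ENNReal.toReal_nonneg ENNReal.toReal_nonneg ENNReal.toReal_nonneg ENNReal.toReal_nonneg hsum
  simp only [smul_eq_mul] at hconv
  rw [hμ, ENNReal.toReal_add hs₁ hs₂, ← hx₁, ← hx₂, ENNReal.toReal_mul, ENNReal.toReal_mul,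
    mul_comm (μ₁.rnDeriv ν₁ x).toReal, mul_comm (μ₂.rnDeriv ν₂ x).toReal]
  refine (ENNReal.ofReal_le_ofReal hconv).trans (ENNReal.ofReal_add_le.trans_eq ?_)
  rw [ENNReal.ofReal_mul ENNReal.toReal_nonneg, ENNReal.ofReal_mul ENNReal.toReal_nonneg,
    ENNReal.ofReal_toReal ht₁, ENNReal.ofReal_toReal ht₂]

/-- Conditional independence of `f` and `g` given `k` is stable under mixtures of two laws that
share the joint distribution of `(k, f)`. -/
lemma CondIndepFun.mixture {Ω β β' γ : Type*} [MeasurableSpace Ω] [StandardBorelSpace Ω]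
    [MeasurableSpace β] [StandardBorelSpace β] [Nonempty β]
    [MeasurableSpace β'] [StandardBorelSpace β'] [Nonempty β'] [MeasurableSpace γ]
    {f : Ω → β} {g : Ω → β'} {k : Ω → γ} (hf : Measurable f) (hg : Measurable g)
    (hk : Measurable k) {μ₁ μ₂ μ : Measure Ω} [IsFiniteMeasure μ₁] [IsFiniteMeasure μ₂]
    [IsFiniteMeasure μ] {a b : ℝ≥0} (hμ : μ = a • μ₁ + b • μ₂)
    (hkf₁ : μ₁.map (fun ω ↦ (k ω, f ω)) = μ.map (fun ω ↦ (k ω, f ω)))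
    (hkf₂ : μ₂.map (fun ω ↦ (k ω, f ω)) = μ.map (fun ω ↦ (k ω, f ω)))
    (h₁ : f ⟂ᵢ[k, hk; μ₁] g) (h₂ : f ⟂ᵢ[k, hk; μ₂] g) : f ⟂ᵢ[k, hk; μ] g := by
  have key (ν : Measure Ω) [IsFiniteMeasure ν]
      (hν : ν.map (fun ω ↦ (k ω, f ω)) = μ.map (fun ω ↦ (k ω, f ω))) :
      f ⟂ᵢ[k, hk; ν] g ↔ ν.map (fun ω ↦ ((k ω, g ω), f ω)) =
        ν.map (fun ω ↦ (k ω, g ω)) ⊗ₘ (condDistrib f k μ).prodMkRight _ := by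
    have hcd : condDistrib f k ν = condDistrib f k μ := by simp only [condDistrib, hν]
    rw [← hcd, ← condDistrib_ae_eq_iff_measure_eq_compProd _ hf.aemeasurable,
      ← condIndepFun_iff_condDistrib_prod_ae_eq_prodMkRight hf hg hk]
    exact ⟨fun h ↦ h.symm, fun h ↦ h.symm⟩
  rw [key _ ‹_›] at h₁ h₂
  rw [key μ rfl]
  have hm : Measurable fun ω ↦ (k ω, g ω) := by fun_prop
  have hm' : Measurable fun ω ↦ ((k ω, g ω), f ω) := by fun_prop
  nth_rw 1 2 [hμ]
  rw [Measure.map_add _ _ hm, Measure.map_add _ _ hm', Measure.map_smul, Measure.map_smul,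
    Measure.map_smul, Measure.map_smul, h₁, h₂, Measure.compProd_add_left]
  exact congrArg₂ _ (Measure.compProd_smul_left (a : ℝ≥0∞)).symm
    (Measure.compProd_smul_left (b : ℝ≥0∞)).symm

lemma mutualInfoProd_mixture_le {α β : Type*} [MeasurableSpace α] [MeasurableSpace β]
    {P : Measure α} [IsProbabilityMeasure P] {μ₁ μ₂ μ : Measure (α × β)} [IsProbabilityMeasure μ₁]
    [IsProbabilityMeasure μ₂] [IsProbabilityMeasure μ] {a b : ℝ≥0} (hμ : μ = a • μ₁ + b • μ₂)
    (h₁ : μ₁.map Prod.fst = P) (h₂ : μ₂.map Prod.fst = P) (h : μ.map Prod.fst = P) :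
    mutualInfoProd μ ≤ a * mutualInfoProd μ₁ + b * mutualInfoProd μ₂ := by
  have hp (ν : Measure (α × β)) [IsProbabilityMeasure ν] : IsProbabilityMeasure (ν.map Prod.snd) :=
    Measure.isProbabilityMeasure_map (by fun_prop)
  have := hp μ₁
  have := hp μ₂
  have := hp μ
  have hprod : P.prod (μ.map Prod.snd) =
      a • P.prod (μ₁.map Prod.snd) + b • P.prod (μ₂.map Prod.snd) := by
    rw [hμ, Measure.map_add _ _ measurable_snd, Measure.map_smul, Measure.map_smul,
      Measure.prod_add, Measure.prod_smul_right, Measure.prod_smul_right]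
  unfold mutualInfoProd
  rw [h₁, h₂, h, klDivergence_eq_klDiv, klDivergence_eq_klDiv, klDivergence_eq_klDiv, hprod, hμ,
    ← klDiv_smul_same, ← klDiv_smul_same]
  exact klDiv_add_le _ _ _ _

lemma iInf_mem_le_mul_add_mul {ι : Type*} {S₁ S₂ S : Set ι} {F : ι → ℝ≥0∞} {a b : ℝ≥0∞}
    (ha : a ≠ 0) (ha' : a ≠ ∞) (hb : b ≠ 0) (hb' : b ≠ ∞)
    (h : ∀ x ∈ S₁, ∀ y ∈ S₂, ∃ z ∈ S, F z ≤ a * F x + b * F y) :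
    ⨅ z ∈ S, F z ≤ a * (⨅ x ∈ S₁, F x) + b * ⨅ y ∈ S₂, F y := by
  simp_rw [ENNReal.mul_iInf_of_ne ha ha', ENNReal.mul_iInf_of_ne hb hb', ENNReal.iInf_add,
    ENNReal.add_iInf]
  refine le_iInf₂ fun x hx ↦ le_iInf₂ fun y hy ↦ ?_
  obtain ⟨z, hz, hle⟩ := h x hx y hy
  exact (iInf₂_le z hz).trans hle

lemma map_comp_fst_congr {α β δ : Type*} [MeasurableSpace α] [MeasurableSpace β]
    [MeasurableSpace δ] {μ ν : Measure (α × β)} (h : μ.map Prod.fst = ν.map Prod.fst)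
    {φ : α → δ} (hφ : Measurable φ) : μ.map (fun ω ↦ φ ω.1) = ν.map (fun ω ↦ φ ω.1) := by
  have hcomp (ρ : Measure (α × β)) : ρ.map (fun ω ↦ φ ω.1) = (ρ.map Prod.fst).map φ :=
    (Measure.map_map hφ measurable_fst).symm
  rw [hcomp, hcomp, h]

/-- **Convexity and monotonicity of the nonanticipative RDF in the distortion level**
(Lemma 4, finite-alphabet form): for finite alphabets, a fixed source law `P` and a nonnegative
distortion function `d`, the function `D ↦ R^{na}_{0,n}(D)` — the infimum of the mutual
information over joint laws with source marginal `P`, average distortion at most `D` and the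
nonanticipativity constraint `(X_{i+1},…,X_n) ⫫ (Y_0,…,Y_i) | (X_0,…,X_i)` for all `i < n` —
is nonincreasing and convex on `[0, ∞)`. -/
theorem nonanticipativeRDF_monotone_convex
    {n : ℕ} (𝒳 𝒴 : Fin (n + 1) → Type*)
    [∀ j, Fintype (𝒳 j)] [∀ j, Nonempty (𝒳 j)]
    [∀ j, MeasurableSpace (𝒳 j)] [∀ j, DiscreteMeasurableSpace (𝒳 j)]
    [∀ j, Fintype (𝒴 j)] [∀ j, Nonempty (𝒴 j)]
    [∀ j, MeasurableSpace (𝒴 j)] [∀ j, DiscreteMeasurableSpace (𝒴 j)]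
    (Psrc : Measure ((j : Fin (n + 1)) → 𝒳 j)) [IsProbabilityMeasure Psrc]
    (d : (((j : Fin (n + 1)) → 𝒳 j) × ((j : Fin (n + 1)) → 𝒴 j)) → ℝ)
    (hd : ∀ z, 0 ≤ d z)
    (R : ℝ → ℝ≥0∞)
    (hR : R = fun D =>
      ⨅ μ ∈ {μ : ProbabilityMeasure
          (((j : Fin (n + 1)) → 𝒳 j) × ((j : Fin (n + 1)) → 𝒴 j)) |
          μ.toMeasure.map Prod.fst = Psrc ∧
          (∫ z, d z ∂μ.toMeasure) ≤ (n + 1) * D ∧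
          ∀ i : ℕ, ∀ hi : i < n,
            CondIndepFun
              (MeasurableSpace.comap
                (fun ω : ((j : Fin (n + 1)) → 𝒳 j) × ((j : Fin (n + 1)) → 𝒴 j) =>
                  fun j : Fin (i + 1) => ω.1 (Fin.castLE (by omega) j)) inferInstance)
              ((measurable_pi_lambda _ fun j : Fin (i + 1) =>
                  (measurable_pi_apply _).comp measurable_fst).comap_le)
              (fun ω => fun j : Fin (n - i) => ω.1 ⟨i + 1 + j.1, by have := j.isLt; omega⟩)
              (fun ω => fun j : Fin (i + 1) => ω.2 (Fin.castLE (by omega) j))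
              μ.toMeasure},
        mutualInfoProd μ.toMeasure) :
    (∀ D₁ D₂ : ℝ, 0 ≤ D₁ → D₁ ≤ D₂ → R D₂ ≤ R D₁) ∧
    (∀ D₁ D₂ lam : ℝ, 0 ≤ D₁ → 0 ≤ D₂ → 0 ≤ lam → lam ≤ 1 →
      R (lam * D₁ + (1 - lam) * D₂) ≤
        ENNReal.ofReal lam * R D₁ + ENNReal.ofReal (1 - lam) * R D₂) := by
  subst hR
  refine ⟨fun D₁ D₂ _ hD ↦ ?_, fun D₁ D₂ lam hD₁ hD₂ h0 h1 ↦ ?_⟩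
  · refine biInf_mono fun μ hμ ↦ ⟨hμ.1, hμ.2.1.trans ?_, hμ.2.2⟩
    gcongr
  rcases h0.eq_or_lt with rfl | h0
  · simp
  rcases h1.eq_or_lt with rfl | h1
  · simp
  refine iInf_mem_le_mul_add_mul (by simpa) (by simp) (by simpa) (by simp) ?_
  rintro μ₁ ⟨hP₁, hd₁, hc₁⟩ μ₂ ⟨hP₂, hd₂, hc₂⟩
  lift lam to ℝ≥0 using h0.le
  obtain ⟨b, hb⟩ : ∃ b : ℝ≥0, (b : ℝ) = 1 - lam := ⟨⟨1 - lam, by linarith⟩, rfl⟩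
  have hab : lam + b = 1 := by
    rw [← NNReal.coe_inj]; push_cast; linarith
  rw [← hb]
  simp only [ENNReal.ofReal_coe_nnreal]
  set μ := lam • μ₁.toMeasure + b • μ₂.toMeasure with hμ
  have hμprob : IsProbabilityMeasure μ := ⟨by
    simp only [hμ, Measure.add_apply, Measure.smul_apply, measure_univ]
    simp only [ENNReal.smul_def, smul_eq_mul, mul_one]
    exact_mod_cast hab⟩
  have hP : μ.map Prod.fst = Psrc := by
    rw [hμ, Measure.map_add _ _ measurable_fst, Measure.map_smul, Measure.map_smul, hP₁, hP₂,
      ← add_smul, hab, one_smul]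
  refine ⟨⟨μ, hμprob⟩, ⟨hP, ?_, fun i hi ↦ ?_⟩, mutualInfoProd_mixture_le (μ := μ) hμ hP₁ hP₂ hP⟩
  · change ∫ z, d z ∂μ ≤ _
    rw [hμ, integral_add_measure .of_finite .of_finite, integral_smul_nnreal_measure,
      integral_smul_nnreal_measure]
    simp only [NNReal.smul_def, smul_eq_mul]
    have := mul_le_mul_of_nonneg_left hd₁ lam.coe_nonneg
    have := mul_le_mul_of_nonneg_left hd₂ b.coe_nonneg
    linarith
  · have hφ : Measurable fun x : (j : Fin (n + 1)) → 𝒳 j ↦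
        (fun j : Fin (i + 1) ↦ x (Fin.castLE (by omega) j),
          fun j : Fin (n - i) ↦ x ⟨i + 1 + j.1, by have := j.isLt; omega⟩) := by
      fun_prop
    exact CondIndepFun.mixture (μ := μ) (by fun_prop) (by fun_prop) (by fun_prop) hμ
      (map_comp_fst_congr (hP₁.trans hP.symm) hφ) (map_comp_fst_congr (hP₂.trans hP.symm) hφ)
      (hc₁ i hi) (hc₂ i hi)
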